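/- Let G be a free group of finite rank r with free generating set S, acting on a standard Borel probability space (X, μ) by μ-preserving Borel automorphisms, let α be a generating partition with H(α) < ∞, and let Σ be a G-invariant sub-σ-algebra. Then the limit lim_{n→∞} [(1 − r)·H(B_n·α / Σ) + (1/2)·H(B_{n+1}·α / B_n·α ∨ Σ)] exists in [−∞, ∞) and equals lim_{n→∞} F_G(X, μ/Σ, S, B_n·α) (the relative f-invariant entropy f_G(X, μ/Σ)). -/

import Mathlib

open MeasureTheory Filter Set
open scoped ENNReal symmDiff Pointwise

namespace FPaper

/-- The free group of rank `r`; its free generating set `S` is `{FreeGroup.of i | i : Fin r}`. -/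
abbrev FG (r : ℕ) := FreeGroup (Fin r)

/-- The reduced `S`-word length of a group element. -/
def wlen {r : ℕ} (g : FG r) : ℕ := g.toWord.length

/-- The ball of radius `n` in `FG r` with respect to the word length. -/
def ball (r n : ℕ) : Set (FG r) := {g | wlen g ≤ n}

instance ballFinite (r n : ℕ) : Finite (ball r n) := by
  have h : ball r n ⊆ FreeGroup.mk '' {l : List (Fin r × Bool) | l.length ≤ n} :=
    fun g hg => ⟨g.toWord, hg, FreeGroup.mk_toWord⟩
  exact (((List.finite_length_le _ n).image _).subset h).to_subtype

/-- An action of a group `G` on a measurable space `X` by Borel automorphisms. -/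
structure BorelAction (G : Type*) [Group G] (X : Type*) [MeasurableSpace X] where
  act : G → X → X
  act_one : ∀ x, act 1 x = x
  act_mul : ∀ g h x, act (g * h) x = act g (act h x)
  measurable_act : ∀ g, Measurable (act g)

namespace BorelAction

variable {G X : Type*} [Group G] [mX : MeasurableSpace X]

/-- The action preserves the measure `μ`. -/
def Preserves (T : BorelAction G X) (μ : Measure X) : Prop :=
  ∀ g : G, MeasurePreserving (T.act g) μ μ

/-- The translated set `g · B`. -/
def smulSet (T : BorelAction G X) (g : G) (B : Set X) : Set X := T.act g⁻¹ ⁻¹' B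

/-- The translated partition `g · α`, where a countable measurable partition is recorded
by a (measurable, countably-valued) function whose fibers are the cells. -/
def tr {I : Type*} (T : BorelAction G X) (g : G) (a : X → I) : X → I :=
  fun x => a (T.act g⁻¹ x)

/-- The join `F · α = ⋁_{f ∈ F} f · α` of the translates of a partition over a set `F ⊆ G`. -/
def joinF {I : Type*} (T : BorelAction G X) (F : Set G) (a : X → I) : X → (F → I) :=
  fun x f => a (T.act (f : G)⁻¹ x)

/-- The σ-algebra generated by the partitions `f · α`, `f ∈ F`. -/
def partSA {I : Type*} (T : BorelAction G X) (F : Set G) (a : X → I) : MeasurableSpace X :=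
  ⨆ f ∈ F, MeasurableSpace.comap (T.tr f a) ⊤

/-- The partition `a` is generating: the smallest `G`-invariant σ-algebra containing `a`
(i.e. the one generated by all translates of `a`) contains every measurable set up to
`ν`-null sets. -/
def Generating {I : Type*} (T : BorelAction G X) (a : X → I) (ν : Measure X) : Prop :=
  ∀ B : Set X, MeasurableSet B →
    ∃ B', MeasurableSet[T.partSA Set.univ a] B' ∧ ν (B ∆ B') = 0

/-- Ergodicity of the action with respect to `ν`. -/
def IsErgodic (T : BorelAction G X) (ν : Measure X) : Prop :=
  ∀ B : Set X, MeasurableSet B → (∀ g : G, ν (T.smulSet g B ∆ B) = 0) → ν B = 0 ∨ ν B = 1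

/-- The action is essentially free with respect to `ν`. -/
def EssentiallyFree (T : BorelAction G X) (ν : Measure X) : Prop :=
  ν {x | ∀ g : G, g ≠ 1 → T.act g x ≠ x} = 1

/-- The stabilizer subgroup of a point. -/
def stab (T : BorelAction G X) (y : X) : Subgroup G where
  carrier := {g | T.act g y = y}
  one_mem' := T.act_one y
  mul_mem' := by
    intro g h hg hh
    simp only [Set.mem_setOf_eq] at *
    rw [T.act_mul, hh, hg]
  inv_mem' := by
    intro g hg
    simp only [Set.mem_setOf_eq] at *
    conv_lhs => rw [← hg]
    rw [← T.act_mul, inv_mul_cancel, T.act_one]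

end BorelAction

/-- `m` is a `G`-invariant sub-σ-algebra. -/
def InvariantSA {G X : Type*} [Group G] (m : MeasurableSpace X) [mX : MeasurableSpace X]
    (T : BorelAction G X) : Prop :=
  m ≤ mX ∧ ∀ (g : G) (B : Set X), MeasurableSet[m] B → MeasurableSet[m] (T.act g ⁻¹' B)

/-- A measure is purely atomic: the set of atoms has full measure. -/
def PurelyAtomic {X : Type*} [MeasurableSpace X] (ν : Measure X) : Prop :=
  ν {x | 0 < ν {x}} = 1

/-- Shannon entropy of a countable measurable partition (recorded as a countably-valued
function), with values in `[0, ∞]`. -/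
noncomputable def Hpart {X I : Type*} [MeasurableSpace X] [Countable I]
    (μ : Measure X) (a : X → I) : ℝ≥0∞ :=
  ∑' i : I, ENNReal.ofReal (Real.negMulLog (μ (a ⁻¹' {i})).toReal)

/-- Conditional Shannon entropy of a countable partition given a sub-σ-algebra `m`:
`H(α/m) = ∫ ∑_{A ∈ α} φ(E[1_A | m](x)) dμ(x)` with `φ(t) = -t log t`. -/
noncomputable def condEntS {X I : Type*} (m : MeasurableSpace X) [mX : MeasurableSpace X]
    [Countable I] (μ : Measure X) (a : X → I) : ℝ≥0∞ :=
  ∫⁻ x, ∑' i : I,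
    ENNReal.ofReal (Real.negMulLog ((μ[(a ⁻¹' {i}).indicator (fun _ => (1:ℝ)) | m]) x)) ∂μ

/-- Conditional Shannon entropy of a partition given another partition:
`H(α/β) = ∑_{B ∈ β} ∑_{A ∈ α} -μ(B) · (μ(A∩B)/μ(B)) · log (μ(A∩B)/μ(B))`
(equivalently `H(α ∨ β) − H(β)`), with values in `[0, ∞]`. -/
noncomputable def condEntP {X I J : Type*} [MeasurableSpace X] [Countable I] [Countable J]
    (μ : Measure X) (a : X → I) (b : X → J) : ℝ≥0∞ :=
  ∑' q : I × J, μ (b ⁻¹' {q.2}) *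
    ENNReal.ofReal (Real.negMulLog
      ((μ (a ⁻¹' {q.1} ∩ b ⁻¹' {q.2})).toReal / (μ (b ⁻¹' {q.2})).toReal))

/-- `F_G(X, μ, S, β) = (1-2r)·H(β) + ∑_{s ∈ S} H(s·β ∨ β)`. -/
noncomputable def FF {r : ℕ} {X I : Type*} [MeasurableSpace X] [Countable I]
    (μ : Measure X) (T : BorelAction (FG r) X) (b : X → I) : ℝ :=
  (1 - 2 * (r : ℝ)) * (Hpart μ b).toReal
    + ∑ i : Fin r, (Hpart μ (fun x => (T.tr (FreeGroup.of i) b x, b x))).toReal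

/-- The sequence `n ↦ F_G(X, μ, S, B_n · α)`. -/
noncomputable def fSeq {r : ℕ} {X : Type*} [MeasurableSpace X]
    (μ : Measure X) (T : BorelAction (FG r) X) (a : X → ℕ) (n : ℕ) : ℝ :=
  FF μ T (T.joinF (ball r n) a)

/-- The f-invariant entropy `f_G(X, μ) = lim_n F_G(X, μ, S, B_n·α)`, the limit (= infimum,
since the sequence is non-increasing) of the sequence `fSeq`, with values in `[-∞, ∞)`. -/
noncomputable def fInv {r : ℕ} {X : Type*} [MeasurableSpace X]
    (μ : Measure X) (T : BorelAction (FG r) X) (a : X → ℕ) : EReal :=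
  ⨅ n : ℕ, ((fSeq μ T a n : ℝ) : EReal)

/-- Relative version `F_G(X, μ/Σ, S, β) = (1-2r)·H(β/Σ) + ∑_{s ∈ S} H(s·β ∨ β / Σ)`. -/
noncomputable def FFrel {r : ℕ} {X I : Type*} (m : MeasurableSpace X) [mX : MeasurableSpace X]
    [Countable I] (μ : Measure X) (T : BorelAction (FG r) X) (b : X → I) : ℝ :=
  (1 - 2 * (r : ℝ)) * (condEntS m μ b).toReal
    + ∑ i : Fin r, (condEntS m μ (fun x => (T.tr (FreeGroup.of i) b x, b x))).toReal

/-- The sequence `n ↦ F_G(X, μ/Σ, S, B_n · α)`. -/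
noncomputable def fSeqRel {r : ℕ} {X : Type*} (m : MeasurableSpace X) [mX : MeasurableSpace X]
    (μ : Measure X) (T : BorelAction (FG r) X) (a : X → ℕ) (n : ℕ) : ℝ :=
  FFrel m μ T (T.joinF (ball r n) a)

/-- The relative f-invariant entropy `f_G(X, μ/Σ)`, with values in `[-∞, ∞)`. -/
noncomputable def fInvRel {r : ℕ} {X : Type*} (m : MeasurableSpace X) [mX : MeasurableSpace X]
    (μ : Measure X) (T : BorelAction (FG r) X) (a : X → ℕ) : EReal :=
  ⨅ n : ℕ, ((fSeqRel m μ T a n : ℝ) : EReal)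

/-- A total order on `S ∪ S⁻¹` is recorded by an injection `ord : Fin r × Bool → ℕ`;
`g ≺ h` iff `|g| < |h|`, or `|g| = |h|` and the reduced word of `g` lexicographically
precedes that of `h`. -/
def wlt {r : ℕ} (ord : Fin r × Bool → ℕ) (g h : FG r) : Prop :=
  wlen g < wlen h ∨ (wlen g = wlen h ∧ List.Lex (fun p q => ord p < ord q) g.toWord h.toWord)

/-- `Pre(g)`: the set of elements strictly preceding `g`. -/
def Pre {r : ℕ} (ord : Fin r × Bool → ℕ) (g : FG r) : Set (FG r) := {h | wlt ord h g}

/-- The generator or inverse generator corresponding to a letter. -/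
def letter {r : ℕ} (p : Fin r × Bool) : FG r :=
  if p.2 then FreeGroup.of p.1 else (FreeGroup.of p.1)⁻¹

/-- The first (leftmost) letter of the reduced word of `g` (junk value `1` for `g = 1`). -/
def firstLetter {r : ℕ} (g : FG r) : FG r := ((g.toWord.head?).map letter).getD 1

/-- The independence decay `δ(g, α/Σ)`, as a real number:
`δ(g, α/Σ) = H(s⁻¹g·α / Pre(s⁻¹g)·α ∨ Σ) − H(g·α / Pre(g)·α ∨ Σ)` where `s` is the first
letter of `g`. -/
noncomputable def idecay {r : ℕ} {X I : Type*} (m : MeasurableSpace X) [mX : MeasurableSpace X]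
    [Countable I] (μ : Measure X) (T : BorelAction (FG r) X)
    (ord : Fin r × Bool → ℕ) (a : X → I) (g : FG r) : ℝ :=
  (condEntS (m ⊔ T.partSA (Pre ord ((firstLetter g)⁻¹ * g)) a) μ
      (T.tr ((firstLetter g)⁻¹ * g) a)).toReal
  - (condEntS (m ⊔ T.partSA (Pre ord g) a) μ (T.tr g a)).toReal

/-- The entropy `H(τ)` of a probability space: the supremum of the Shannon entropies of
finite measurable partitions. -/
noncomputable def measEnt {M : Type*} [MeasurableSpace M] (τ : Measure M) : ℝ≥0∞ :=
  ⨆ (P : Finset (Set M)) (_ : ∀ p ∈ P, MeasurableSet p)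
    (_ : (P : Set (Set M)).PairwiseDisjoint id) (_ : ⋃₀ (P : Set (Set M)) = Set.univ),
    ∑ p ∈ P, ENNReal.ofReal (Real.negMulLog (τ p).toReal)

/-- The non-negative part of an extended real, in `ℝ≥0∞`. -/
noncomputable def erealToENNReal (x : EReal) : ℝ≥0∞ :=
  if x = ⊤ then ⊤ else ENNReal.ofReal x.toReal

/-- The integral of an `EReal`-valued function (positive part minus negative part),
with values in `[-∞, ∞]`. -/
noncomputable def eIntegral {M : Type*} [MeasurableSpace M] (τ : Measure M) (f : M → EReal) :
    EReal :=
  ((∫⁻ m, erealToENNReal (f m) ∂τ : ℝ≥0∞) : EReal)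
    - ((∫⁻ m, erealToENNReal (-(f m)) ∂τ : ℝ≥0∞) : EReal)

/-- The set of `G`-invariant Borel probability measures on `X`. -/
def InvProb {G X : Type*} [Group G] [MeasurableSpace X] (T : BorelAction G X) :
    Set (Measure X) :=
  {ν | IsProbabilityMeasure ν ∧ ∀ g : G, MeasurePreserving (T.act g) ν ν}

section ConditionalProbability

variable {X : Type*} (m : MeasurableSpace X) [mX : MeasurableSpace X] [StandardBorelSpace X]
  (μ : Measure X) [IsProbabilityMeasure μ]

/-- A version of the conditional probability of `A` given `m`, with values in `[0, ∞]`. -/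
noncomputable def condProb (A : Set X) (x : X) : ℝ≥0∞ := ProbabilityTheory.condExpKernel μ m x A

variable {m μ}

theorem measurable_condProb {A : Set X} (hA : MeasurableSet A) : Measurable[m] (condProb m μ A) :=
  ProbabilityTheory.measurable_condExpKernel hA

theorem condProb_le_one (A : Set X) (x : X) : condProb m μ A x ≤ 1 := prob_le_one

theorem condProb_ne_top (A : Set X) (x : X) : condProb m μ A x ≠ ∞ := measure_ne_top _ _

theorem tsum_condProb_inter {I : Type*} [Countable I] {a : X → I}
    (ha : ∀ i, MeasurableSet (a ⁻¹' {i})) {B : Set X} (hB : MeasurableSet B) (x : X) :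
    ∑' i, condProb m μ (a ⁻¹' {i} ∩ B) x = condProb m μ B x := by
  have hU : (⋃ i, a ⁻¹' {i} ∩ B) = B := by ext y; simp
  unfold condProb
  rw [← measure_iUnion ?_ fun i => (ha i).inter hB, hU]
  intro i j hij
  refine Set.disjoint_left.2 fun y hy hy' => hij ?_
  exact hy.1.symm.trans hy'.1

/-- Pulling an `m`-measurable factor out of a conditional probability. -/
theorem lintegral_mul_condProb (hm : m ≤ mX) {A : Set X} (hA : MeasurableSet A) {g : X → ℝ≥0∞}
    (hg : Measurable[m] g) : ∫⁻ x, g x * condProb m μ A x ∂μ = ∫⁻ x in A, g x ∂μ := by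
  have hF : Measurable[m.prod mX] fun z : X × X => g z.1 * A.indicator 1 z.2 :=
    (hg.comp measurable_fst).mul ((measurable_one.indicator hA).comp measurable_snd)
  have h := congrArg (fun ν => ∫⁻ z, g z.1 * A.indicator 1 z.2 ∂ν)
    (ProbabilityTheory.compProd_trim_condExpKernel (μ := μ) hm)
  rw [Measure.lintegral_compProd hF, @lintegral_map X (X × X) mX (m.prod mX) μ _
    Function.diag hF (Measurable.prodMk (measurable_id'' hm) measurable_id)] at h
  have h1 : ∀ x, ∫⁻ y, g x * A.indicator 1 y ∂(ProbabilityTheory.condExpKernel μ m x)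
      = g x * condProb m μ A x := fun x => by
    rw [lintegral_const_mul _ (measurable_one.indicator hA), lintegral_indicator_one hA, condProb]
  simp only [h1, Function.diag] at h
  rw [lintegral_trim hm (f := fun x => g x * condProb m μ A x) (hg.mul (measurable_condProb hA))] at h
  rw [h, ← lintegral_indicator hA]
  refine lintegral_congr fun x => ?_
  by_cases hx : x ∈ A <;> simp [hx]

theorem setLIntegral_condProb (hm : m ≤ mX) {A : Set X} (hA : MeasurableSet A) {s : Set X}
    (hs : MeasurableSet[m] s) : ∫⁻ x in s, condProb m μ A x ∂μ = μ (s ∩ A) := by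
  have h := lintegral_mul_condProb (μ := μ) hm hA (g := s.indicator 1)
    (Measurable.indicator (@measurable_const _ _ _ m 1) hs)
  rw [lintegral_indicator_one (hm s hs), Measure.restrict_apply (hm s hs)] at h
  rw [← h, ← lintegral_indicator (hm s hs)]
  refine lintegral_congr fun x => ?_
  by_cases hx : x ∈ s <;> simp [hx]

theorem lintegral_condProb (hm : m ≤ mX) {A : Set X} (hA : MeasurableSet A) :
    ∫⁻ x, condProb m μ A x ∂μ = μ A := by
  simpa using setLIntegral_condProb (μ := μ) hm hA (s := univ) MeasurableSet.univ

theorem ae_eq_condProb (hm : m ≤ mX) {A : Set X} (hA : MeasurableSet A) {f : X → ℝ≥0∞}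
    (hf : Measurable[m] f) (h : ∀ s, MeasurableSet[m] s → ∫⁻ x in s, f x ∂μ = μ (s ∩ A)) :
    f =ᵐ[μ] condProb m μ A := by
  refine ae_eq_of_ae_eq_trim (hm := hm)
    (ae_eq_of_forall_setLIntegral_eq_of_sigmaFinite hf (measurable_condProb hA) fun s hs _ => ?_)
  rw [setLIntegral_trim hm hf hs, setLIntegral_trim hm (measurable_condProb hA) hs, h s hs,
    setLIntegral_condProb hm hA hs]

end ConditionalProbability

section Entropy

/-- The function `t ↦ -t log t` on `[0, ∞]`. -/
noncomputable def eta (p : ℝ≥0∞) : ℝ≥0∞ := ENNReal.ofReal (Real.negMulLog p.toReal)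

/-- The information function `t ↦ -log t` on `[0, ∞]`, infinite at `0`. -/
noncomputable def info (p : ℝ≥0∞) : ℝ≥0∞ := if p = 0 then ∞ else ENNReal.ofReal (-Real.log p.toReal)

theorem measurable_eta : Measurable eta :=
  (Real.continuous_negMulLog.measurable.comp ENNReal.measurable_toReal).ennreal_ofReal

theorem measurable_info : Measurable info :=
  Measurable.ite (measurableSet_singleton 0) measurable_const
    (Real.measurable_log.comp ENNReal.measurable_toReal).neg.ennreal_ofReal

@[simp] theorem eta_zero : eta 0 = 0 := by simp [eta]

theorem info_mul_self {p : ℝ≥0∞} (hp : p ≠ ∞) : info p * p = eta p := by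
  by_cases h : p = 0
  · simp [h]
  · have h0 : 0 ≤ p.toReal := ENNReal.toReal_nonneg
    simp only [info, h, if_false, eta, Real.negMulLog]
    nth_rw 2 [← ENNReal.ofReal_toReal hp]
    rw [← ENNReal.ofReal_mul' h0]
    congr 1; ring

theorem eta_add_le {p q : ℝ≥0∞} (hp : p ≤ 1) (hq : q ≤ 1) :
    eta q + q ≤ info p * q + p := by
  have hp' : p ≠ ∞ := ne_top_of_le_ne_top ENNReal.one_ne_top hp
  have hq' : q ≠ ∞ := ne_top_of_le_ne_top ENNReal.one_ne_top hq
  by_cases q0 : q = 0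
  · simp [q0]
  by_cases p0 : p = 0
  · simp [p0, info, ENNReal.top_mul q0]
  lift p to NNReal using hp'
  lift q to NNReal using hq'
  have hp1 : (p : ℝ) ≤ 1 := by exact_mod_cast hp
  have hq1 : (q : ℝ) ≤ 1 := by exact_mod_cast hq
  have hp2 : 0 < (p : ℝ) := by
    have : p ≠ 0 := by exact_mod_cast p0
    positivity
  have hq2 : 0 < (q : ℝ) := by
    have : q ≠ 0 := by exact_mod_cast q0
    positivity
  have hlp := Real.log_nonpos hp2.le hp1
  simp only [eta, info, p0, if_false, ENNReal.coe_toReal, Real.negMulLog]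
  rw [← ENNReal.ofReal_coe_nnreal (p := p), ← ENNReal.ofReal_coe_nnreal (p := q),
    ← ENNReal.ofReal_mul (by linarith), ← ENNReal.ofReal_add _ hq2.le,
    ← ENNReal.ofReal_add _ hp2.le]
  · apply ENNReal.ofReal_le_ofReal
    have h := Real.log_le_sub_one_of_pos (div_pos hp2 hq2)
    rw [Real.log_div hp2.ne' hq2.ne'] at h
    have h2 := mul_le_mul_of_nonneg_left h hq2.le
    rw [mul_sub, mul_sub, mul_div_cancel₀ _ hq2.ne'] at h2
    linarith
  · exact mul_nonneg (by linarith) hq2.le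
  · have := Real.log_nonpos hq2.le hq1
    nlinarith

/-- The pointwise chain rule for `-t log t`. -/
theorem eta_eq_add {p q : ℝ≥0∞} (hpq : p ≤ q) (hq : q ≤ 1) :
    eta p = q * eta (p / q) + info q * p := by
  have hq' : q ≠ ∞ := ne_top_of_le_ne_top ENNReal.one_ne_top hq
  have hp' : p ≠ ∞ := ne_top_of_le_ne_top hq' hpq
  by_cases p0 : p = 0
  · simp [p0]
  have q0 : q ≠ 0 := fun h => p0 (le_antisymm (h ▸ hpq) zero_le)
  lift p to NNReal using hp'
  lift q to NNReal using hq'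
  have hq1 : (q : ℝ) ≤ 1 := by exact_mod_cast hq
  have hpq1 : (p : ℝ) ≤ q := by exact_mod_cast hpq
  have hp2 : 0 < (p : ℝ) := by
    have : p ≠ 0 := by exact_mod_cast p0
    positivity
  have hq2 : 0 < (q : ℝ) := by
    have : q ≠ 0 := by exact_mod_cast q0
    positivity
  have hlq := Real.log_nonpos hq2.le hq1
  have hd : (p : ℝ) / q ≤ 1 := (div_le_one hq2).2 hpq1
  simp only [eta, info, q0, if_false, ENNReal.coe_toReal, ENNReal.toReal_div]
  conv_rhs =>
    rw [← ENNReal.ofReal_coe_nnreal (p := p), ← ENNReal.ofReal_coe_nnreal (p := q)]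
  rw [← ENNReal.ofReal_mul hq2.le, ← ENNReal.ofReal_mul (by linarith), ← ENNReal.ofReal_add]
  · congr 1
    rw [Real.negMulLog, Real.negMulLog, Real.log_div hp2.ne' hq2.ne']
    field_simp
    ring
  · exact mul_nonneg hq2.le (Real.negMulLog_nonneg (by positivity) hd)
  · exact mul_nonneg (by linarith) hp2.le

end Entropy

section ChainRule

theorem tsum_indicator_fiber {X J : Type*} (b : X → J) (F : J → X → ℝ≥0∞) (x : X) :
    ∑' j, (b ⁻¹' {j}).indicator (F j) x = F (b x) x := by
  rw [tsum_eq_single (b x)]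
  · simp
  · intro j hj
    exact indicator_of_notMem (fun h => hj h.symm) _

theorem exists_inter_fiber_eq {X J : Type*} (m : MeasurableSpace X) (b : X → J) {s : Set X}
    (hs : MeasurableSet[m ⊔ MeasurableSpace.comap b ⊤] s) (j : J) :
    ∃ M, MeasurableSet[m] M ∧ s ∩ b ⁻¹' {j} = M ∩ b ⁻¹' {j} := by
  let m₁ : MeasurableSpace X :=
    { MeasurableSet' := fun s => ∃ M, MeasurableSet[m] M ∧ s ∩ b ⁻¹' {j} = M ∩ b ⁻¹' {j}
      measurableSet_empty := ⟨∅, @MeasurableSet.empty _ m, rfl⟩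
      measurableSet_compl := by
        rintro s ⟨M, hM, h⟩
        refine ⟨Mᶜ, hM.compl, ?_⟩
        ext x
        have := Set.ext_iff.1 h x
        simp only [mem_inter_iff, mem_compl_iff] at this ⊢
        tauto
      measurableSet_iUnion := by
        intro s hs
        choose M hM h using hs
        refine ⟨⋃ n, M n, MeasurableSet.iUnion hM, ?_⟩
        simp only [iUnion_inter, h] }
  have hle : m ⊔ MeasurableSpace.comap b ⊤ ≤ m₁ := by
    refine sup_le (fun t ht => ⟨t, ht, rfl⟩) ?_
    rintro _ ⟨B, -, rfl⟩
    by_cases hj : j ∈ B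
    · refine ⟨univ, @MeasurableSet.univ _ m, ?_⟩
      ext x
      simp only [mem_inter_iff, mem_preimage, mem_singleton_iff, mem_univ, true_and,
        and_iff_right_iff_imp]
      rintro rfl
      exact hj
    · refine ⟨∅, @MeasurableSet.empty _ m, ?_⟩
      ext x
      simp only [mem_inter_iff, mem_preimage, mem_singleton_iff, mem_empty_iff_false, false_and,
        iff_false, not_and]
      rintro h rfl
      exact hj h
  exact hle s hs

theorem comap_top_le_of_measurableSet_fiber {X J : Type*} [Countable J] [mX : MeasurableSpace X]
    {b : X → J} (hb : ∀ j, MeasurableSet (b ⁻¹' {j})) :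
    MeasurableSpace.comap b ⊤ ≤ mX := by
  rintro _ ⟨B, -, rfl⟩
  rw [← biUnion_preimage_singleton]
  exact MeasurableSet.biUnion (to_countable B) fun j _ => hb j

variable {X I J : Type*} [Countable I] [Countable J] {m : MeasurableSpace X}
  [mX : MeasurableSpace X] [StandardBorelSpace X] {μ : Measure X} [IsProbabilityMeasure μ]

theorem measurable_eta_condProb (hm : m ≤ mX) {A : Set X} (hA : MeasurableSet A) :
    Measurable fun x => eta (condProb m μ A x) :=
  measurable_eta.comp ((measurable_condProb hA).mono hm le_rfl)

theorem condEntS_eq_tsum (hm : m ≤ mX) {a : X → I} (ha : ∀ i, MeasurableSet (a ⁻¹' {i})) :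
    condEntS m μ a = ∑' i, ∫⁻ x, eta (condProb m μ (a ⁻¹' {i}) x) ∂μ := by
  rw [← lintegral_tsum fun i =>
    (measurable_eta_condProb hm (ha i)).aemeasurable]
  refine lintegral_congr_ae ?_
  have h : ∀ᵐ x ∂μ, ∀ i, (ProbabilityTheory.condExpKernel μ m x).real (a ⁻¹' {i})
      = (μ[(a ⁻¹' {i}).indicator (fun _ => (1 : ℝ)) | m]) x :=
    ae_all_iff.2 fun i => ProbabilityTheory.condExpKernel_ae_eq_condExp hm (ha i)
  filter_upwards [h] with x hx
  refine tsum_congr fun i => ?_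
  rw [← hx i]
  rfl

/-- Conditioning on a larger σ-algebra decreases entropy. -/
theorem condEntS_anti {X I : Type*} [Countable I] {m m' : MeasurableSpace X}
    [mX : MeasurableSpace X] [StandardBorelSpace X] {μ : Measure X} [IsProbabilityMeasure μ]
    (hmm : m ≤ m') (hm' : m' ≤ mX) {a : X → I}
    (ha : ∀ i, MeasurableSet (a ⁻¹' {i})) : condEntS m' μ a ≤ condEntS m μ a := by
  have hm := hmm.trans hm'
  rw [condEntS_eq_tsum hm ha, condEntS_eq_tsum hm' ha]
  refine ENNReal.tsum_le_tsum fun i => ?_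
  have hp := measurable_condProb (m := m) (μ := μ) (ha i)
  have hq := measurable_condProb (m := m') (μ := μ) (ha i)
  have hinfo : Measurable[m] fun x => info (condProb m μ (a ⁻¹' {i}) x) := measurable_info.comp hp
  have h1 : ∫⁻ x, (eta (condProb m' μ (a ⁻¹' {i}) x) + condProb m' μ (a ⁻¹' {i}) x) ∂μ
      ≤ ∫⁻ x, (info (condProb m μ (a ⁻¹' {i}) x) * condProb m' μ (a ⁻¹' {i}) x
        + condProb m μ (a ⁻¹' {i}) x) ∂μ :=
    lintegral_mono fun x => eta_add_le (condProb_le_one _ _) (condProb_le_one _ _)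
  rw [lintegral_add_right _ (hq.mono hm' le_rfl), lintegral_add_right _ (hp.mono hm le_rfl),
    lintegral_mul_condProb hm' (ha i) (hinfo.mono hmm le_rfl),
    ← lintegral_mul_condProb hm (ha i) hinfo, lintegral_condProb hm (ha i),
    lintegral_condProb hm' (ha i)] at h1
  simp only [info_mul_self (condProb_ne_top _ _)] at h1
  exact (ENNReal.add_le_add_iff_right (measure_ne_top _ _)).1 h1

/-- The conditional probability given `m` and a countable partition. -/
theorem condProb_sup_ae_eq (hm : m ≤ mX) {b : X → J} (hb : ∀ j, MeasurableSet (b ⁻¹' {j}))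
    {A : Set X} (hA : MeasurableSet A) :
    (fun x => condProb m μ (A ∩ b ⁻¹' {b x}) x / condProb m μ (b ⁻¹' {b x}) x)
      =ᵐ[μ] condProb (m ⊔ MeasurableSpace.comap b ⊤) μ A := by
  set F : J → X → ℝ≥0∞ := fun j x => condProb m μ (A ∩ b ⁻¹' {j}) x / condProb m μ (b ⁻¹' {j}) x
  have hF : ∀ j, Measurable[m] (F j) := fun j =>
    (measurable_condProb (hA.inter (hb j))).div (measurable_condProb (hb j))
  have hle : m ⊔ MeasurableSpace.comap b ⊤ ≤ mX := sup_le hm (comap_top_le_of_measurableSet_fiber hb)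
  have hFeq : (fun x => F (b x) x) = fun x => ∑' j, (b ⁻¹' {j}).indicator (F j) x :=
    funext fun x => (tsum_indicator_fiber b F x).symm
  change (fun x => F (b x) x) =ᵐ[μ] _
  rw [hFeq]
  refine ae_eq_condProb hle hA ?_ fun s hs => ?_
  · have htsum : ∀ {Y : Type _} [MeasurableSpace Y] {f : J → Y → ℝ≥0∞}, (∀ j, Measurable (f j)) →
        Measurable fun y => ∑' j, f j y := fun hf => Measurable.tsum hf
    refine @htsum X (m ⊔ MeasurableSpace.comap b ⊤) _ fun j =>
      Measurable.indicator ((hF j).mono le_sup_left le_rfl) ?_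
    exact (le_sup_right : MeasurableSpace.comap b ⊤ ≤ _) _ ⟨{j}, trivial, rfl⟩
  · rw [lintegral_tsum fun j => (((hF j).mono hm le_rfl).indicator (hb j)).aemeasurable]
    have hsX := hle s hs
    have hterm : ∀ j, ∫⁻ x in s, (b ⁻¹' {j}).indicator (F j) x ∂μ
        = μ (b ⁻¹' {j} ∩ (s ∩ A)) := by
      intro j
      obtain ⟨M, hM, hMs⟩ := exists_inter_fiber_eq m b hs j
      have hFM : Measurable[m] (M.indicator (F j)) := (hF j).indicator hM
      have hcancel : ∀ x, F j x * condProb m μ (b ⁻¹' {j}) x = condProb m μ (A ∩ b ⁻¹' {j}) x := by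
        intro x
        by_cases h0 : condProb m μ (b ⁻¹' {j}) x = 0
        · have : condProb m μ (A ∩ b ⁻¹' {j}) x = 0 := measure_mono_null inter_subset_right h0
          rw [h0, this, mul_zero]
        · exact ENNReal.div_mul_cancel h0 (condProb_ne_top _ _)
      calc ∫⁻ x in s, (b ⁻¹' {j}).indicator (F j) x ∂μ
          = ∫⁻ x in b ⁻¹' {j}, M.indicator (F j) x ∂μ := by
            rw [lintegral_indicator (hb j), Measure.restrict_restrict (hb j), inter_comm, hMs,
              lintegral_indicator (hm M hM), Measure.restrict_restrict (hm M hM)]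
        _ = ∫⁻ x, M.indicator (F j) x * condProb m μ (b ⁻¹' {j}) x ∂μ :=
            (lintegral_mul_condProb hm (hb j) hFM).symm
        _ = ∫⁻ x in M, condProb m μ (A ∩ b ⁻¹' {j}) x ∂μ := by
            rw [← lintegral_indicator (hm M hM)]
            refine lintegral_congr fun x => ?_
            by_cases hx : x ∈ M
            · simp only [indicator_of_mem hx, hcancel]
            · simp only [indicator_of_notMem hx, zero_mul]
        _ = μ (M ∩ (A ∩ b ⁻¹' {j})) := setLIntegral_condProb hm (hA.inter (hb j)) hM
        _ = μ (b ⁻¹' {j} ∩ (s ∩ A)) := by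
            congr 1
            rw [inter_left_comm, ← hMs, inter_left_comm, inter_comm A, ← inter_assoc,
              inter_comm s]
            rw [inter_assoc]
    simp only [hterm]
    rw [← measure_iUnion]
    · congr 1; ext x; simp
    · intro i j hij
      exact Set.disjoint_left.2 fun y hy hy' => hij (hy.1.symm.trans hy'.1)
    · exact fun j => (hb j).inter (hsX.inter hA)

/-- The chain rule for conditional entropy. -/
theorem condEntS_prod (hm : m ≤ mX) {a : X → I} {b : X → J} (ha : ∀ i, MeasurableSet (a ⁻¹' {i}))
    (hb : ∀ j, MeasurableSet (b ⁻¹' {j})) :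
    condEntS m μ (fun x => (a x, b x))
      = condEntS m μ b + condEntS (m ⊔ MeasurableSpace.comap b ⊤) μ a := by
  have hle : m ⊔ MeasurableSpace.comap b ⊤ ≤ mX := sup_le hm (comap_top_le_of_measurableSet_fiber hb)
  have hpair : ∀ i j, (fun x => (a x, b x)) ⁻¹' {(i, j)} = a ⁻¹' {i} ∩ b ⁻¹' {j} := by
    intro i j; ext x; simp
  have hab : ∀ q : I × J, MeasurableSet ((fun x => (a x, b x)) ⁻¹' {q}) := by
    rintro ⟨i, j⟩
    rw [hpair]
    exact (ha i).inter (hb j)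
  have hquot : ∀ i j, Measurable[m] fun x =>
      eta (condProb m μ (a ⁻¹' {i} ∩ b ⁻¹' {j}) x / condProb m μ (b ⁻¹' {j}) x) := fun i j =>
    measurable_eta.comp
      ((measurable_condProb ((ha i).inter (hb j))).div (measurable_condProb (hb j)))
  have hcond : ∀ i, ∫⁻ x, eta (condProb (m ⊔ MeasurableSpace.comap b ⊤) μ (a ⁻¹' {i}) x) ∂μ
      = ∑' j, ∫⁻ x, condProb m μ (b ⁻¹' {j}) x *
        eta (condProb m μ (a ⁻¹' {i} ∩ b ⁻¹' {j}) x / condProb m μ (b ⁻¹' {j}) x) ∂μ := by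
    intro i
    have h1 : ∫⁻ x, eta (condProb (m ⊔ MeasurableSpace.comap b ⊤) μ (a ⁻¹' {i}) x) ∂μ
        = ∫⁻ x, ∑' j, (b ⁻¹' {j}).indicator (fun x =>
          eta (condProb m μ (a ⁻¹' {i} ∩ b ⁻¹' {j}) x / condProb m μ (b ⁻¹' {j}) x)) x ∂μ := by
      refine lintegral_congr_ae ?_
      filter_upwards [condProb_sup_ae_eq (μ := μ) hm hb (ha i)] with x hx
      rw [tsum_indicator_fiber, ← hx]
    rw [h1, lintegral_tsum fun j => (((hquot i j).mono hm le_rfl).indicator (hb j)).aemeasurable]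
    refine tsum_congr fun j => ?_
    rw [lintegral_indicator (hb j), ← lintegral_mul_condProb hm (hb j) (hquot i j)]
    exact lintegral_congr fun x => mul_comm _ _
  rw [condEntS_eq_tsum hm hab, condEntS_eq_tsum hm hb, condEntS_eq_tsum hle ha]
  simp only [hcond]
  rw [ENNReal.tsum_comm (α := I), ← ENNReal.tsum_add, ENNReal.tsum_prod', ENNReal.tsum_comm]
  refine tsum_congr fun j => ?_
  have hmeas : ∀ i, Measurable fun x => condProb m μ (b ⁻¹' {j}) x *
      eta (condProb m μ (a ⁻¹' {i} ∩ b ⁻¹' {j}) x / condProb m μ (b ⁻¹' {j}) x) := fun i =>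
    ((measurable_condProb (hb j)).mono hm le_rfl).mul ((hquot i j).mono hm le_rfl)
  simp only [hpair]
  rw [← lintegral_tsum fun i => (hmeas i).aemeasurable,
    ← lintegral_tsum fun i => 
      (measurable_eta_condProb hm ((ha i).inter (hb j))).aemeasurable,
    ← lintegral_add_left (measurable_eta_condProb hm (hb j))]
  refine lintegral_congr fun x => ?_
  have hsplit : ∀ i, eta (condProb m μ (a ⁻¹' {i} ∩ b ⁻¹' {j}) x)
      = condProb m μ (b ⁻¹' {j}) x *
          eta (condProb m μ (a ⁻¹' {i} ∩ b ⁻¹' {j}) x / condProb m μ (b ⁻¹' {j}) x)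
        + info (condProb m μ (b ⁻¹' {j}) x) * condProb m μ (a ⁻¹' {i} ∩ b ⁻¹' {j}) x := fun i =>
    eta_eq_add (measure_mono inter_subset_right) (condProb_le_one _ _)
  rw [tsum_congr hsplit, ENNReal.tsum_add, ENNReal.tsum_mul_left, ENNReal.tsum_mul_left,
    tsum_condProb_inter ha (hb j), info_mul_self (condProb_ne_top _ _), add_comm]

end ChainRule

section Relabelling

variable {X I J : Type*} [Countable I] [Countable J] {m : MeasurableSpace X}
  [mX : MeasurableSpace X] [StandardBorelSpace X] {μ : Measure X} [IsProbabilityMeasure μ]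

theorem condEntS_comp_injective (hm : m ≤ mX) {b : X → J} (hb : ∀ j, MeasurableSet (b ⁻¹' {j}))
    {f : J → I} (hf : f.Injective) : condEntS m μ (fun x => f (b x)) = condEntS m μ b := by
  have hpre : ∀ j, (fun x => f (b x)) ⁻¹' {f j} = b ⁻¹' {j} := fun j => by
    ext x; simp [hf.eq_iff]
  have hempty : ∀ i, i ∉ range f → (fun x => f (b x)) ⁻¹' {i} = ∅ := fun i hi =>
    eq_empty_of_forall_notMem fun x hx => hi ⟨b x, hx⟩
  have hfb : ∀ i, MeasurableSet ((fun x => f (b x)) ⁻¹' {i}) := fun i => by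
    by_cases hi : i ∈ range f
    · obtain ⟨j, rfl⟩ := hi
      rw [hpre]; exact hb j
    · rw [hempty i hi]; exact MeasurableSet.empty
  rw [condEntS_eq_tsum hm hb, condEntS_eq_tsum hm hfb, ← hf.tsum_eq]
  · simp only [hpre]
  · refine fun i hi => by_contra fun hir => hi ?_
    simp [hempty i hir, condProb]

theorem condEntS_prod_comm (hm : m ≤ mX) {a : X → I} {b : X → J}
    (ha : ∀ i, MeasurableSet (a ⁻¹' {i})) (hb : ∀ j, MeasurableSet (b ⁻¹' {j})) :
    condEntS m μ (fun x => (a x, b x)) = condEntS m μ (fun x => (b x, a x)) := by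
  refine condEntS_comp_injective hm (b := fun x => (b x, a x)) ?_ Prod.swap_injective
  rintro ⟨j, i⟩
  convert (hb j).inter (ha i) using 1
  ext x; simp

/-- A coarser partition has smaller conditional entropy. -/
theorem condEntS_le_of_factorsThrough (hm : m ≤ mX) {a : X → I} {b : X → J}
    (ha : ∀ i, MeasurableSet (a ⁻¹' {i})) (hb : ∀ j, MeasurableSet (b ⁻¹' {j}))
    (hab : a.FactorsThrough b) : condEntS m μ a ≤ condEntS m μ b := by
  have : Nonempty X := nonempty_of_isProbabilityMeasure μ
  have : Nonempty I := this.map a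
  obtain ⟨e, he⟩ := (Function.factorsThrough_iff a).1 hab
  have h1 : condEntS m μ (fun x => (a x, b x)) = condEntS m μ b := by
    subst he
    exact condEntS_comp_injective hm hb (f := fun j => (e j, j)) fun j j' h => congrArg Prod.snd h
  rw [← h1, condEntS_prod_comm hm ha hb, condEntS_prod hm hb ha]
  exact le_self_add

theorem condEntS_congr_fibers (hm : m ≤ mX) {a : X → I} {b : X → J}
    (ha : ∀ i, MeasurableSet (a ⁻¹' {i})) (hb : ∀ j, MeasurableSet (b ⁻¹' {j}))
    (hab : ∀ x y, a x = a y ↔ b x = b y) : condEntS m μ a = condEntS m μ b :=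
  le_antisymm (condEntS_le_of_factorsThrough hm ha hb fun x y h => (hab x y).2 h)
    (condEntS_le_of_factorsThrough hm hb ha fun x y h => (hab x y).1 h)

theorem condProb_comp_ae_eq (hm : m ≤ mX) {T T' : X → X} (hT : MeasurePreserving T μ μ)
    (hTm : Measurable[m, m] T) (hTm' : Measurable[m, m] T') (hTT' : ∀ x, T' (T x) = x)
    {A : Set X} (hA : MeasurableSet A) :
    (fun x => condProb m μ A (T x)) =ᵐ[μ] condProb m μ (T ⁻¹' A) := by
  refine ae_eq_condProb hm (hT.measurable hA) ((measurable_condProb hA).comp hTm) fun s hs => ?_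
  have hs' : MeasurableSet[m] (T' ⁻¹' s) := hTm' hs
  have hpre : T ⁻¹' (T' ⁻¹' s) = s := by ext x; simp [hTT']
  rw [← hpre, hT.setLIntegral_comp_preimage (hm _ hs') ((measurable_condProb hA).mono hm le_rfl),
    setLIntegral_condProb hm hA hs', ← preimage_inter,
    hT.measure_preimage ((hm _ hs').inter hA).nullMeasurableSet]

theorem condEntS_comp_measurePreserving (hm : m ≤ mX) {T T' : X → X}
    (hT : MeasurePreserving T μ μ) (hTm : Measurable[m, m] T) (hTm' : Measurable[m, m] T')
    (hTT' : ∀ x, T' (T x) = x) {a : X → I} (ha : ∀ i, MeasurableSet (a ⁻¹' {i})) :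
    condEntS m μ (fun x => a (T x)) = condEntS m μ a := by
  rw [condEntS_eq_tsum hm ha, condEntS_eq_tsum hm (a := fun x => a (T x)) fun i => hT.measurable (ha i)]
  refine tsum_congr fun i => ?_
  rw [← hT.lintegral_comp (measurable_eta_condProb hm (ha i))]
  refine lintegral_congr_ae ?_
  filter_upwards [condProb_comp_ae_eq hm hT hTm hTm' hTT' (ha i)] with x hx
  rw [hx]
  rfl

theorem condEntS_bot {X I : Type*} [Countable I] [MeasurableSpace X] (μ : Measure X)
    [IsProbabilityMeasure μ] {a : X → I} (ha : ∀ i, MeasurableSet (a ⁻¹' {i})) :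
    condEntS ⊥ μ a = Hpart μ a := by
  simp only [condEntS, condExp_bot, Hpart]
  rw [lintegral_const, measure_univ, mul_one]
  refine tsum_congr fun i => ?_
  rw [integral_indicator (ha i)]
  simp [Measure.real]

theorem condEntS_le_Hpart (hm : m ≤ mX) {a : X → I} (ha : ∀ i, MeasurableSet (a ⁻¹' {i})) :
    condEntS m μ a ≤ Hpart μ a :=
  (condEntS_anti bot_le hm ha).trans_eq (condEntS_bot μ ha)

end Relabelling

section Joins

open BorelAction

variable {G X : Type*} [Group G] {m : MeasurableSpace X}
  [mX : MeasurableSpace X] {T : BorelAction G X} {a : X → ℕ}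

theorem joinF_eq_iff (F : Set G) (x y : X) :
    T.joinF F a x = T.joinF F a y ↔ ∀ f ∈ F, a (T.act f⁻¹ x) = a (T.act f⁻¹ y) := by
  simp [funext_iff, joinF]

theorem measurableSet_joinF (ha : Measurable a) (F : Set G) [Finite F] (φ : F → ℕ) :
    MeasurableSet (T.joinF F a ⁻¹' {φ}) := by
  have h : Measurable (T.joinF F a) :=
    measurable_pi_lambda _ fun f => ha.comp (T.measurable_act _)
  exact h (measurableSet_singleton φ)

theorem partSA_eq_comap (F : Set G) [Finite F] :
    T.partSA F a = MeasurableSpace.comap (T.joinF F a) ⊤ := by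
  refine le_antisymm (iSup₂_le fun f hf => ?_) ?_
  · rintro _ ⟨B, -, rfl⟩
    exact ⟨(fun φ : F → ℕ => φ ⟨f, hf⟩) ⁻¹' B, trivial, rfl⟩
  · refine @comap_top_le_of_measurableSet_fiber X (F → ℕ) _ (T.partSA F a) _ fun φ => ?_
    have hφ : T.joinF F a ⁻¹' {φ} = ⋂ f : F, T.tr f a ⁻¹' {φ f} := by
      ext x; simp [funext_iff, joinF, tr]
    rw [hφ]
    refine @MeasurableSet.iInter X F (T.partSA F a) _ _ fun f => ?_
    exact (le_iSup₂_of_le (f := fun f (_ : f ∈ F) => MeasurableSpace.comap (T.tr f a) ⊤) f.1 f.2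
      le_rfl) _ ⟨{φ f}, trivial, rfl⟩

theorem partSA_mono {C A : Set G} (h : C ⊆ A) : T.partSA C a ≤ T.partSA A a :=
  biSup_mono fun _ hf => h hf

theorem partSA_le (ha : Measurable a) (F : Set G) [Finite F] : T.partSA F a ≤ mX :=
  partSA_eq_comap (T := T) (a := a) F ▸
    comap_top_le_of_measurableSet_fiber (measurableSet_joinF ha F)

theorem tr_joinF_eq_iff (g : G) (F : Set G) (x y : X) :
    T.tr g (T.joinF F a) x = T.tr g (T.joinF F a) y ↔
      ∀ f ∈ g • F, a (T.act f⁻¹ x) = a (T.act f⁻¹ y) := by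
  simp only [tr, joinF_eq_iff, ← image_smul, forall_mem_image, smul_eq_mul, mul_inv_rev, T.act_mul]

theorem measurableSet_tr {I : Type*} {b : X → I} (hb : ∀ i, MeasurableSet (b ⁻¹' {i})) (g : G)
    (i : I) : MeasurableSet (T.tr g b ⁻¹' {i}) :=
  T.measurable_act g⁻¹ (hb i)

instance finite_smul_set {G : Type*} [Group G] (g : G) (F : Set G) [Finite F] :
    Finite ↥(g • F) :=
  ((toFinite F).image (g • ·)).to_subtype

variable [StandardBorelSpace X] {μ : Measure X} [IsProbabilityMeasure μ]

theorem condEntS_joinF_add (hm : m ≤ mX) (ha : Measurable a) (A B : Set G) [Finite A] [Finite B] :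
    condEntS m μ (T.joinF A a) + condEntS (m ⊔ T.partSA A a) μ (T.joinF B a)
      = condEntS m μ (T.joinF (A ∪ B) a) := by
  rw [partSA_eq_comap, ← condEntS_prod hm (measurableSet_joinF ha B) (measurableSet_joinF ha A)]
  refine condEntS_congr_fibers hm ?_ (measurableSet_joinF ha _) fun x y => ?_
  · rintro ⟨φ, ψ⟩
    convert (measurableSet_joinF (T := T) ha B φ).inter
      (measurableSet_joinF (T := T) ha A ψ) using 1
    ext x; simp
  · simp only [Prod.mk.injEq, joinF_eq_iff, mem_union, or_imp, forall_and]
    tauto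

theorem condEntS_joinF_submodular (hm : m ≤ mX) (ha : Measurable a) {A B C : Set G}
    [Finite A] [Finite B] [Finite C] (hCA : C ⊆ A) (hCB : C ⊆ B) :
    condEntS m μ (T.joinF (A ∪ B) a) + condEntS m μ (T.joinF C a)
      ≤ condEntS m μ (T.joinF A a) + condEntS m μ (T.joinF B a) := by
  have hB : condEntS m μ (T.joinF B a) = condEntS m μ (T.joinF (C ∪ B) a) := by
    refine condEntS_congr_fibers hm (measurableSet_joinF ha _) (measurableSet_joinF ha _)
      fun x y => ?_
    rw [joinF_eq_iff, joinF_eq_iff, union_eq_self_of_subset_left hCB]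
  rw [hB, ← condEntS_joinF_add hm ha C B, ← condEntS_joinF_add hm ha A B, add_assoc,
    add_comm (condEntS m μ (T.joinF C a))]
  gcongr
  exact condEntS_anti (sup_le_sup_left (partSA_mono hCA) m) (sup_le hm (partSA_le ha A))
    (measurableSet_joinF ha B)

theorem condEntS_tr (hm : InvariantSA m T) (hT : T.Preserves μ) {I : Type*} [Countable I]
    {b : X → I} (hb : ∀ i, MeasurableSet (b ⁻¹' {i})) (g : G) :
    condEntS m μ (T.tr g b) = condEntS m μ b :=
  condEntS_comp_measurePreserving hm.1 (hT g⁻¹) (fun _ hB => hm.2 _ _ hB)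
    (T' := T.act g) (fun _ hB => hm.2 _ _ hB)
    (fun x => by rw [← T.act_mul, mul_inv_cancel, T.act_one]) hb

theorem condEntS_joinF_smul (hm : InvariantSA m T) (hT : T.Preserves μ) (ha : Measurable a)
    (g : G) (F : Set G) [Finite F] :
    condEntS m μ (T.joinF (g • F) a) = condEntS m μ (T.joinF F a) := by
  rw [← condEntS_tr hm hT (measurableSet_joinF ha F) g]
  refine condEntS_congr_fibers hm.1 (measurableSet_joinF ha _)
    (measurableSet_tr (measurableSet_joinF ha F) g) fun x y => ?_
  rw [joinF_eq_iff, tr_joinF_eq_iff]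

theorem condEntS_tr_joinF_prod (hm : m ≤ mX) (ha : Measurable a) (g : G) (F : Set G) [Finite F] :
    condEntS m μ (fun x => (T.tr g (T.joinF F a) x, T.joinF F a x))
      = condEntS m μ (T.joinF (g • F ∪ F) a) := by
  refine condEntS_congr_fibers hm ?_ (measurableSet_joinF ha _) fun x y => ?_
  · rintro ⟨φ, ψ⟩
    convert (measurableSet_tr (T := T) (measurableSet_joinF (T := T) ha F) g φ).inter
      (measurableSet_joinF (T := T) ha F ψ) using 1
    ext x; simp
  · simp only [Prod.mk.injEq, joinF_eq_iff, tr_joinF_eq_iff, mem_union, or_imp, forall_and]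

theorem condEntS_joinF_ne_top (hm : m ≤ mX) (hT : T.Preserves μ) (ha : Measurable a)
    (hent : Hpart μ a < ⊤) (F : Set G) [Finite F] : condEntS m μ (T.joinF F a) ≠ ⊤ := by
  have htr : ∀ g : G, Hpart μ (T.tr g a) = Hpart μ a := fun g => by
    refine tsum_congr fun i => ?_
    have h := (hT g⁻¹).measure_preimage (ha (measurableSet_singleton i)).nullMeasurableSet
    rw [← h]
    rfl
  have ha' : ∀ i, MeasurableSet (a ⁻¹' {i}) := fun i => ha (measurableSet_singleton i)
  obtain ⟨s, rfl⟩ := (toFinite F).exists_finset_coe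
  suffices ∀ s : Finset G, condEntS m μ (T.joinF (s : Set G) a) ≠ ⊤ from this s
  classical
  clear! s
  intro s
  induction s using Finset.induction_on with
  | empty =>
    refine ne_top_of_le_ne_top hent.ne (le_trans ?_ (condEntS_le_Hpart hm ha'))
    refine condEntS_le_of_factorsThrough hm (measurableSet_joinF ha _) ha' fun x y _ => ?_
    rw [joinF_eq_iff]
    simp
  | insert g s _ ih =>
    have hpair : condEntS m μ (T.joinF (↑(insert g s) : Set G) a)
        = condEntS m μ (fun x => (T.tr g a x, T.joinF (s : Set G) a x)) := by
      refine condEntS_congr_fibers hm (measurableSet_joinF ha _) ?_ fun x y => ?_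
      · rintro ⟨i, ψ⟩
        convert (measurableSet_tr (T := T) ha' g i).inter
          (measurableSet_joinF (T := T) ha (s : Set G) ψ) using 1
        ext x; simp
      · rw [Prod.mk.injEq, joinF_eq_iff, joinF_eq_iff]
        simp [tr]
    rw [hpair, condEntS_prod hm (measurableSet_tr ha' g) (measurableSet_joinF ha _)]
    refine ENNReal.add_ne_top.2 ⟨ih, ?_⟩
    refine ne_top_of_le_ne_top ((htr g).trans_ne hent.ne)
      (condEntS_le_Hpart ?_ (measurableSet_tr ha' g))
    exact sup_le hm (comap_top_le_of_measurableSet_fiber (measurableSet_joinF ha _))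

end Joins

section Balls

variable {r : ℕ}

theorem wlen_mul_le (g k : FG r) : wlen (g * k) ≤ wlen g + wlen k := FreeGroup.norm_mul_le g k

theorem letter_eq_mk (p : Fin r × Bool) : letter p = FreeGroup.mk [p] := by
  rcases p with ⟨i, _ | _⟩ <;> simp [letter, FreeGroup.of, FreeGroup.invRev]

theorem wlen_letter_le (p : Fin r × Bool) : wlen (letter p) ≤ 1 := by
  rw [letter_eq_mk]
  exact FreeGroup.norm_mk_le

theorem ball_mono (r : ℕ) {k n : ℕ} (h : k ≤ n) : ball r k ⊆ ball r n := fun _ hg => le_trans hg h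

theorem finite_ball (r n : ℕ) : (ball r n).Finite := toFinite _

theorem letter_smul_ball_subset (p : Fin r × Bool) (n : ℕ) :
    letter p • ball r n ⊆ ball r (n + 1) := by
  rintro _ ⟨g, hg, rfl⟩
  have h1 := wlen_mul_le (letter p) g
  have h2 := wlen_letter_le p
  have h3 : wlen g ≤ n := hg
  change wlen (letter p * g) ≤ n + 1
  omega

theorem ball_subset_letter_smul_ball (p : Fin r × Bool) (n : ℕ) :
    ball r n ⊆ letter p • ball r (n + 1) := by
  intro g hg
  refine mem_smul_set_iff_inv_smul_mem.2 ?_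
  have h1 := wlen_mul_le (letter p)⁻¹ g
  have h2 : wlen (letter p)⁻¹ = wlen (letter p) := FreeGroup.norm_inv_eq
  have h3 := wlen_letter_le p
  have h4 : wlen g ≤ n := hg
  change wlen ((letter p)⁻¹ * g) ≤ n + 1
  omega

theorem ball_succ (r n : ℕ) :
    ball r (n + 1) = ball r n ∪ ⋃ p ∈ (Finset.univ : Finset (Fin r × Bool)),
      letter p • ball r n := by
  refine Subset.antisymm (fun g hg => ?_)
    (union_subset (ball_mono r n.le_succ) (iUnion₂_subset fun p _ => letter_smul_ball_subset p n))
  have hg' : g.toWord.length ≤ n + 1 := hg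
  rcases hw : g.toWord with _ | ⟨p, l⟩
  · left
    change g.toWord.length ≤ n
    simp [hw]
  · right
    simp only [Finset.mem_univ, iUnion_true, mem_iUnion]
    refine ⟨p, FreeGroup.mk l, ?_, ?_⟩
    · have h1 : wlen (FreeGroup.mk l) ≤ l.length := FreeGroup.norm_mk_le
      rw [hw, List.length_cons] at hg'
      change wlen (FreeGroup.mk l) ≤ n
      omega
    · simp only [letter_eq_mk, smul_eq_mul, FreeGroup.mul_mk]
      rw [← FreeGroup.mk_toWord (x := g), hw]
      rfl

end Balls

section SubmodularFunctions

variable {r : ℕ} {h : Set (FG r) → ℝ}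

/-- A submodular function on the finite subsets of a free group. -/
def IsSubmodular (h : Set (FG r) → ℝ) : Prop :=
  ∀ ⦃A B C : Set (FG r)⦄, A.Finite → B.Finite → C ⊆ A → C ⊆ B → h (A ∪ B) + h C ≤ h A + h B

theorem IsSubmodular.sub_le_sum (hsub : IsSubmodular h) (n : ℕ) (L : Finset (Fin r × Bool)) :
    h (ball r n ∪ ⋃ p ∈ L, letter p • ball r n) - h (ball r n)
      ≤ ∑ p ∈ L, (h (letter p • ball r n ∪ ball r n) - h (ball r n)) := by
  classical
  induction L using Finset.induction_on with
  | empty => simp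
  | insert p L hp ih =>
    rw [Finset.sum_insert hp]
    have hfin : ∀ q : Fin r × Bool, (letter q • ball r n).Finite := fun q =>
      (finite_ball r n).smul_set
    have key := hsub (A := letter p • ball r n ∪ ball r n)
      (B := ball r n ∪ ⋃ q ∈ L, letter q • ball r n) (C := ball r n)
      ((hfin p).union (finite_ball r n))
      ((finite_ball r n).union (L.finite_toSet.biUnion fun q _ => hfin q))
      subset_union_right subset_union_left
    have hset : letter p • ball r n ∪ ball r n ∪ (ball r n ∪ ⋃ q ∈ L, letter q • ball r n)
        = ball r n ∪ ⋃ q ∈ insert p L, letter q • ball r n := by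
      rw [Finset.set_biUnion_insert]
      ext x
      simp only [mem_union]
      tauto
    rw [hset] at key
    linarith

theorem IsSubmodular.ball_succ_sub_le (hsub : IsSubmodular h)
    (hinv : ∀ (g : FG r) (F : Set (FG r)), F.Finite → h (g • F) = h F) (n : ℕ) :
    h (ball r (n + 1)) - h (ball r n)
      ≤ 2 * ∑ i : Fin r, (h (FreeGroup.of i • ball r n ∪ ball r n) - h (ball r n)) := by
  have key := hsub.sub_le_sum n Finset.univ
  rw [← ball_succ, Fintype.sum_prod_type] at key
  refine key.trans_eq ?_
  rw [Finset.mul_sum]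
  refine Finset.sum_congr rfl fun i _ => ?_
  have hflip : h ((FreeGroup.of i)⁻¹ • ball r n ∪ ball r n)
      = h (FreeGroup.of i • ball r n ∪ ball r n) := by
    rw [← hinv (FreeGroup.of i) _ ((finite_ball r n).smul_set.union (finite_ball r n)),
      smul_set_union, smul_inv_smul, union_comm]
  rw [Fintype.sum_bool]
  simp only [letter, if_true, Bool.false_eq_true, if_false, hflip]
  ring

theorem IsSubmodular.translate_ball_succ_le (hsub : IsSubmodular h)
    (hinv : ∀ (g : FG r) (F : Set (FG r)), F.Finite → h (g • F) = h F) (n : ℕ) (i : Fin r) :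
    h (FreeGroup.of i • ball r (n + 1) ∪ ball r (n + 1))
        + h (FreeGroup.of i • ball r n ∪ ball r n)
      ≤ 2 * h (ball r (n + 1)) := by
  have hl : letter (i, true) = FreeGroup.of i := rfl
  have key := hsub (A := FreeGroup.of i • ball r (n + 1)) (B := ball r (n + 1))
    (C := FreeGroup.of i • ball r n ∪ ball r n) (finite_ball r _).smul_set (finite_ball r _)
    (union_subset (smul_set_mono (ball_mono r n.le_succ)) (hl ▸ ball_subset_letter_smul_ball _ n))
    (union_subset (hl ▸ letter_smul_ball_subset _ n) (ball_mono r n.le_succ))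
  rw [hinv _ _ (finite_ball r _)] at key
  linarith

end SubmodularFunctions

section Limit

open Classical in
/-- The conditional entropy of `F · α` given `m` as a real-valued function of the finite set `F`
(junk value `0` for infinite `F`). -/
noncomputable def joinEnt {r : ℕ} {X : Type*} (m : MeasurableSpace X) [mX : MeasurableSpace X]
    (μ : Measure X) (T : BorelAction (FG r) X) (a : X → ℕ) (F : Set (FG r)) : ℝ :=
  if hF : F.Finite then
    haveI := hF.to_subtype
    (condEntS m μ (T.joinF F a)).toReal
  else 0

variable {r : ℕ} {X : Type*} {m : MeasurableSpace X} [mX : MeasurableSpace X]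
  {μ : Measure X} {T : BorelAction (FG r) X} {a : X → ℕ}

theorem joinEnt_eq (F : Set (FG r)) [Finite F] :
    joinEnt m μ T a F = (condEntS m μ (T.joinF F a)).toReal :=
  dif_pos (toFinite F)

variable [StandardBorelSpace X] [IsProbabilityMeasure μ]

theorem joinEnt_isSubmodular (hm : m ≤ mX) (hT : T.Preserves μ) (ha : Measurable a)
    (hent : Hpart μ a < ⊤) : IsSubmodular (joinEnt m μ T a) := by
  intro A B C hA hB hCA hCB
  have := hA.to_subtype
  have := hB.to_subtype
  have := (hA.subset hCA).to_subtype
  have hfin : ∀ (F : Set (FG r)) [Finite F], condEntS m μ (T.joinF F a) ≠ ⊤ :=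
    fun F _ => condEntS_joinF_ne_top hm hT ha hent F
  simp only [joinEnt_eq]
  rw [← ENNReal.toReal_add (hfin _) (hfin _), ← ENNReal.toReal_add (hfin _) (hfin _)]
  exact ENNReal.toReal_mono (ENNReal.add_ne_top.2 ⟨hfin _, hfin _⟩)
    (condEntS_joinF_submodular hm ha hCA hCB)

theorem joinEnt_smul (hm : InvariantSA m T) (hT : T.Preserves μ) (ha : Measurable a) (g : FG r)
    (F : Set (FG r)) (hF : F.Finite) : joinEnt m μ T a (g • F) = joinEnt m μ T a F := by
  have := hF.to_subtype
  rw [joinEnt_eq, joinEnt_eq, condEntS_joinF_smul hm hT ha]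

theorem toReal_condEntS_ball_succ (hm : m ≤ mX) (hT : T.Preserves μ) (ha : Measurable a)
    (hent : Hpart μ a < ⊤) (n : ℕ) :
    (condEntS (m ⊔ T.partSA (ball r n) a) μ (T.joinF (ball r (n + 1)) a)).toReal
      = joinEnt m μ T a (ball r (n + 1)) - joinEnt m μ T a (ball r n) := by
  have h := condEntS_joinF_add (T := T) (μ := μ) hm ha (ball r n) (ball r (n + 1))
  have hfin := condEntS_joinF_ne_top hm hT ha hent (ball r n ∪ ball r (n + 1))
  have h' := congrArg ENNReal.toReal h
  rw [← h] at hfin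
  rw [ENNReal.toReal_add (ENNReal.add_ne_top.1 hfin).1 (ENNReal.add_ne_top.1 hfin).2,
    ← joinEnt_eq (ball r n), ← joinEnt_eq (ball r n ∪ ball r (n + 1)),
    union_eq_self_of_subset_left (ball_mono r n.le_succ)] at h'
  linarith

theorem fSeqRel_eq (hm : m ≤ mX) (ha : Measurable a) (n : ℕ) :
    fSeqRel m μ T a n = (1 - 2 * (r : ℝ)) * joinEnt m μ T a (ball r n)
      + ∑ i : Fin r, joinEnt m μ T a (FreeGroup.of i • ball r n ∪ ball r n) := by
  simp only [fSeqRel, FFrel, joinEnt_eq, condEntS_tr_joinF_prod hm ha]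

end Limit

/-- A simpler formula for the relative f-invariant entropy:
`f_G(X, μ/Σ) = lim_n (1 − r)·H(B_n·α/Σ) + (1/2)·H(B_{n+1}·α / B_n·α ∨ Σ)`. -/
theorem statement8 {r : ℕ} (hr : 1 ≤ r) {X : Type*}
    (m : MeasurableSpace X) [mX : MeasurableSpace X] [StandardBorelSpace X]
    (μ : Measure X) [IsProbabilityMeasure μ]
    (T : BorelAction (FG r) X) (hT : T.Preserves μ)
    (hm : InvariantSA m T)
    (a : X → ℕ) (ha : Measurable a) (hgen : T.Generating a μ) (hent : Hpart μ a < ⊤) :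
    Filter.Tendsto (fun n : ℕ =>
        (((1 - (r : ℝ)) * (condEntS m μ (T.joinF (ball r n) a)).toReal
          + (1 / 2 : ℝ) *
            (condEntS (m ⊔ T.partSA (ball r n) a) μ (T.joinF (ball r (n + 1)) a)).toReal
          : ℝ) : EReal))
      Filter.atTop (nhds (fInvRel m μ T a)) := by
  have hsub := joinEnt_isSubmodular hm.1 hT ha hent
  have hinv := joinEnt_smul hm hT ha
  have hF := fSeqRel_eq (T := T) (μ := μ) hm.1 ha
  have hG := toReal_condEntS_ball_succ hm.1 hT ha hent
  have hsum : ∀ n, ∑ i : Fin r, (joinEnt m μ T a (FreeGroup.of i • ball r n ∪ ball r n)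
      - joinEnt m μ T a (ball r n))
      = ∑ i : Fin r, joinEnt m μ T a (FreeGroup.of i • ball r n ∪ ball r n)
        - r * joinEnt m μ T a (ball r n) := fun n => by
    simp [Finset.sum_sub_distrib]
  have hupper : ∀ n, (1 - (r : ℝ)) * joinEnt m μ T a (ball r n) + (1 / 2 : ℝ)
      * (joinEnt m μ T a (ball r (n + 1)) - joinEnt m μ T a (ball r n)) ≤ fSeqRel m μ T a n := by
    intro n
    have h1 := hsub.ball_succ_sub_le hinv n
    rw [hsum] at h1
    rw [hF]
    linarith
  have hlower : ∀ n, fSeqRel m μ T a (n + 1) ≤ (1 - (r : ℝ)) * joinEnt m μ T a (ball r n)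
      + (1 / 2 : ℝ) * (joinEnt m μ T a (ball r (n + 1)) - joinEnt m μ T a (ball r n)) := by
    intro n
    have h1 := hsub.ball_succ_sub_le hinv n
    rw [hsum] at h1
    have h2 := Finset.sum_le_sum fun i (_ : i ∈ Finset.univ) =>
      hsub.translate_ball_succ_le hinv n i
    simp only [Finset.sum_add_distrib, Finset.sum_const, Finset.card_univ, Fintype.card_fin,
      nsmul_eq_mul] at h2
    rw [hF]
    linarith
  have hanti : Antitone fun n => ((fSeqRel m μ T a n : ℝ) : EReal) :=
    antitone_nat_of_succ_le fun n => EReal.coe_le_coe_iff.2 ((hlower n).trans (hupper n))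
  have hlim : Tendsto (fun n => ((fSeqRel m μ T a n : ℝ) : EReal)) atTop
      (nhds (fInvRel m μ T a)) := tendsto_atTop_iInf hanti
  simp only [hG, ← joinEnt_eq]
  exact tendsto_of_tendsto_of_tendsto_of_le_of_le ((tendsto_add_atTop_iff_nat 1).2 hlim) hlim
    (fun n => EReal.coe_le_coe_iff.2 (hlower n)) (fun n => EReal.coe_le_coe_iff.2 (hupper n))

end FPaper
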